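/- Let H be a right ℍ-module, let J : H → H be right ℍ-linear with J(Ju) = −u for all u ∈ H, and let ι ∈ 𝕊. If V : H → H is right ℍ-linear and commutes with J (V∘J = J∘V), then V maps H₊^{Jι} = {u : Ju = uι} into itself. Moreover, if W : H → H is another right ℍ-linear map commuting with J and Wu = Vu for every u ∈ H₊^{Jι}, then W = V; that is, a right ℍ-linear map commuting with J is uniquely determined by its restriction to H₊^{Jι}. -/

import Mathlib

/-- A right `ℍ`-module: an additive abelian group `H` with a right scalar multiplication
`smul : H → ℍ → H` satisfying the module axioms. -/
structure RightQModule (H : Type*) [AddCommGroup H] where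
  smul : H → Quaternion ℝ → H
  add_smul : ∀ (u v : H) (q : Quaternion ℝ), smul (u + v) q = smul u q + smul v q
  smul_add : ∀ (u : H) (p q : Quaternion ℝ), smul u (p + q) = smul u p + smul u q
  smul_mul : ∀ (u : H) (p q : Quaternion ℝ), smul u (p * q) = smul (smul u p) q
  smul_one : ∀ u : H, smul u 1 = u

/-- A map `T : H → H` is right `ℍ`-linear when `T (u·a + v·b) = (T u)·a + (T v)·b`. -/
def RightQModule.IsRightLinear {H : Type*} [AddCommGroup H]
    (M : RightQModule H) (T : H → H) : Prop :=
  ∀ (u v : H) (a b : Quaternion ℝ),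
    T (M.smul u a + M.smul v b) = M.smul (T u) a + M.smul (T v) b

namespace RightQModule

variable {H : Type*} [AddCommGroup H] (M : RightQModule H)

theorem smul_zero (u : H) : M.smul u 0 = 0 := by
  simpa using M.smul_add u 0 0

theorem zero_smul (q : Quaternion ℝ) : M.smul 0 q = 0 := by
  simpa using M.add_smul 0 0 q

theorem smul_neg (u : H) (q : Quaternion ℝ) : M.smul u (-q) = -M.smul u q :=
  eq_neg_of_add_eq_zero_left (by rw [← M.smul_add, neg_add_cancel, smul_zero])

theorem neg_smul (u : H) (q : Quaternion ℝ) : M.smul (-u) q = -M.smul u q :=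
  eq_neg_of_add_eq_zero_left (by rw [← M.add_smul, neg_add_cancel, zero_smul])

theorem smul_left_injective {q : Quaternion ℝ} (hq : q ≠ 0) {u v : H}
    (h : M.smul u q = M.smul v q) : u = v := by
  rw [← M.smul_one u, ← M.smul_one v, ← mul_inv_cancel₀ hq, M.smul_mul, M.smul_mul, h]

variable {M} {T : H → H}

theorem IsRightLinear.map_add (hT : M.IsRightLinear T) (u v : H) : T (u + v) = T u + T v := by
  simpa only [M.smul_one] using hT u v 1 1

theorem IsRightLinear.map_smul (hT : M.IsRightLinear T) (u : H) (q : Quaternion ℝ) :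
    T (M.smul u q) = M.smul (T u) q := by
  simpa only [M.smul_zero, add_zero] using hT u 0 q 0

end RightQModule

/-- Orthogonal purely imaginary quaternions anticommute. -/
theorem Quaternion.mul_eq_neg_mul_of_orthogonal {p q : Quaternion ℝ} (hp : p.re = 0)
    (hq : q.re = 0) (h : p.imI * q.imI + p.imJ * q.imJ + p.imK * q.imK = 0) :
    p * q = -(q * p) := by
  ext <;> simp [hp, hq] <;> linarith

/-- Every imaginary unit anticommutes with some nonzero quaternion. -/
theorem Quaternion.exists_ne_zero_anticommute {i : Quaternion ℝ} (hi : i ^ 2 = -1) :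
    ∃ s : Quaternion ℝ, s ≠ 0 ∧ i * s = -(s * i) := by
  have hre : i.re = 0 := by
    have h0 := congrArg (fun q : Quaternion ℝ => q.re) hi
    have h1 := congrArg (fun q : Quaternion ℝ => q.imI) hi
    have h2 := congrArg (fun q : Quaternion ℝ => q.imJ) hi
    have h3 := congrArg (fun q : Quaternion ℝ => q.imK) hi
    simp [pow_two] at h0 h1 h2 h3
    by_contra hne
    have hI : i.imI = 0 := mul_left_cancel₀ hne (by linarith)
    have hJ : i.imJ = 0 := mul_left_cancel₀ hne (by linarith)
    have hK : i.imK = 0 := mul_left_cancel₀ hne (by linarith)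
    rw [hI, hJ, hK] at h0
    nlinarith [mul_self_nonneg i.re]
  by_cases h : i.imI = 0 ∧ i.imJ = 0
  · refine ⟨⟨0, 1, 0, 0⟩, fun h0 => one_ne_zero (congrArg (fun q : Quaternion ℝ => q.imI) h0),
      mul_eq_neg_mul_of_orthogonal hre rfl ?_⟩
    simp [h.1]
  · refine ⟨⟨0, -i.imJ, i.imI, 0⟩, fun h0 => h ⟨?_, ?_⟩, mul_eq_neg_mul_of_orthogonal hre rfl ?_⟩
    · exact congrArg (fun q : Quaternion ℝ => q.imJ) h0
    · exact neg_eq_zero.mp (congrArg (fun q : Quaternion ℝ => q.imI) h0)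
    · dsimp only
      ring

/-- Let `J` be a right `ℍ`-linear map on a right `ℍ`-module with
`J² = −I`, and let `ι ∈ 𝕊`. If `V` is right `ℍ`-linear and commutes with `J`, then `V`
maps `H₊^{Jι} = {u : Ju = u·ι}` into itself; moreover any right `ℍ`-linear `W` commuting
with `J` and agreeing with `V` on `H₊^{Jι}` equals `V` (a right `ℍ`-linear map commuting
with `J` is uniquely determined by its restriction to `H₊^{Jι}`). -/
theorem statement11 {H : Type*} [AddCommGroup H] (M : RightQModule H)
    (J : H → H) (hJlin : M.IsRightLinear J) (hJJ : ∀ u : H, J (J u) = -u)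
    (ι : Quaternion ℝ) (hι : ι ^ 2 = -1)
    (V : H → H) (hVlin : M.IsRightLinear V)
    (hVJ : ∀ u : H, V (J u) = J (V u)) :
    (∀ u : H, J u = M.smul u ι → J (V u) = M.smul (V u) ι) ∧
    (∀ W : H → H, M.IsRightLinear W → (∀ u : H, W (J u) = J (W u)) →
      (∀ u : H, J u = M.smul u ι → W u = V u) → W = V) := by
  refine ⟨fun u hu => by rw [← hVJ, hu, hVlin.map_smul], fun W hW _ hWV => funext fun u => ?_⟩
  obtain ⟨s, hs, hanti⟩ := Quaternion.exists_ne_zero_anticommute hι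
  have hιι (v : H) : M.smul (M.smul v ι) ι = -v := by
    rw [← M.smul_mul, ← pow_two, hι, M.smul_neg, M.smul_one]
  have hJneg : J (M.smul (J u) ι) = -M.smul u ι := by
    rw [hJlin.map_smul, hJJ, M.neg_smul]
  have hplus : W (u + -M.smul (J u) ι) = V (u + -M.smul (J u) ι) := by
    apply hWV
    rw [← M.smul_neg, hJlin.map_add, hJlin.map_smul, hJJ, M.add_smul, M.smul_neg, M.smul_neg,
      M.neg_smul, M.neg_smul, hιι]
    abel
  have hminus : W (u + M.smul (J u) ι) = V (u + M.smul (J u) ι) := by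
    apply M.smul_left_injective hs
    rw [← hW.map_smul, ← hVlin.map_smul]
    apply hWV
    have hJ : J (u + M.smul (J u) ι) = -M.smul (u + M.smul (J u) ι) ι := by
      rw [hJlin.map_add, hJneg, M.add_smul, hιι]
      abel
    rw [hJlin.map_smul, hJ, M.neg_smul, ← M.smul_mul, ← M.smul_mul, hanti, M.smul_neg, neg_neg]
  have hsum : M.smul u (1 + 1) = (u + -M.smul (J u) ι) + (u + M.smul (J u) ι) := by
    rw [M.smul_add, M.smul_one]
    abel
  have htwo : (1 + 1 : Quaternion ℝ) ≠ 0 := fun h => by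
    have hre := congrArg (fun q : Quaternion ℝ => q.re) h
    simp only [Quaternion.re_add, Quaternion.re_one, Quaternion.re_zero] at hre
    norm_num at hre
  apply M.smul_left_injective htwo
  rw [← hW.map_smul, ← hVlin.map_smul, hsum, hW.map_add, hVlin.map_add, hplus, hminus]
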